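/- arXiv:1812.07966 — 2 statements merged into one kernel-verified Lean document; each statement's English description precedes it below -/
import Mathlib

section
/- Let k be an algebraically closed field, m = 2n, and let τ be an endomorphism of k^m such that every eigenspace of τ has dimension at most n. Then there exists an n-dimensional linear subspace V of k^m such that k^m = V ⊕ τ(V). -/
open Module in
/-- A non-scalar endomorphism `N` has an eigenvector of the form `N x`. -/
theorem exists_apply_eigenvector {k W : Type*} [Field k] [IsAlgClosed k] [AddCommGroup W]
    [Module k W] [FiniteDimensional k W] {N : End k W} (hN : N ≠ 0) :
    ∃ (c : k) (x : W), N x ≠ 0 ∧ N (N x) = c • N x := by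
  have : Nontrivial (LinearMap.range N) := by
    rw [Submodule.nontrivial_iff_ne_bot]
    exact fun h => hN (LinearMap.range_eq_bot.mp h)
  obtain ⟨c, hc⟩ := End.exists_eigenvalue
    (N.restrict (p := LinearMap.range N) (q := LinearMap.range N) fun x _ => ⟨x, rfl⟩)
  obtain ⟨⟨_, x, rfl⟩, hy⟩ := hc.exists_hasEigenvector
  refine ⟨c, x, fun h => hy.2 (Subtype.ext h), ?_⟩
  exact congrArg Subtype.val hy.apply_eq_smul

open Module in
/-- A vector generating a two-dimensional invariant subspace and avoiding all the ranges
`range (τ - lam)` of minimal dimension. -/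
theorem exists_quadratic_vector {k W : Type*} [Field k] [IsAlgClosed k] [AddCommGroup W]
    [Module k W] [FiniteDimensional k W] {n : ℕ} (hW : finrank k W = 2 * (n + 1)) (τ : End k W)
    (h : ∀ lam : k, n + 1 ≤ finrank k (LinearMap.range (τ - lam • 1))) :
    ∃ (u : W) (a b : k), LinearIndependent k ![u, τ u] ∧ τ (τ u) = a • u + b • τ u ∧
      ∀ lam : k, u ∈ LinearMap.range (τ - lam • 1) →
        n + 2 ≤ finrank k (LinearMap.range (τ - lam • 1)) := by
  -- It suffices to work with a translate `τ - lam`.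
  have key : ∀ (lam c : k) (u : W), (τ - lam • 1) ((τ - lam • 1) u) = c • (τ - lam • 1) u →
      u ≠ 0 → (∀ a : k, (τ - lam • 1) u ≠ a • u) →
      (∀ mu : k, u ∈ LinearMap.range (τ - mu • 1) →
        n + 2 ≤ finrank k (LinearMap.range (τ - mu • 1))) →
      ∃ (u : W) (a b : k), LinearIndependent k ![u, τ u] ∧ τ (τ u) = a • u + b • τ u ∧
        ∀ mu : k, u ∈ LinearMap.range (τ - mu • 1) →
          n + 2 ≤ finrank k (LinearMap.range (τ - mu • 1)) := by
    intro lam c u hc hu ha hr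
    refine ⟨u, -(lam * lam) - c * lam, 2 * lam + c, ?_, ?_, hr⟩
    · rw [LinearIndependent.pair_iff' hu]
      intro a hau
      apply ha (a - lam)
      simp [← hau, sub_smul]
    · simp only [LinearMap.sub_apply, LinearMap.smul_apply, End.one_apply, map_sub, map_smul,
        smul_sub] at hc
      linear_combination (norm := module) hc
  have hpos : ∀ lam : k, τ - lam • 1 ≠ 0 := by
    intro lam h0
    have := h lam
    rw [h0, LinearMap.range_zero, finrank_bot] at this
    omega
  by_cases hcase : ∃ lam : k, finrank k (LinearMap.range (τ - lam • 1)) = n + 1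
  · obtain ⟨lam, hlam⟩ := hcase
    obtain ⟨c, x, hx, hxc⟩ := exists_apply_eigenvector (hpos lam)
    have hker : finrank k (LinearMap.ker (τ - lam • 1)) = n + 1 := by
      have := LinearMap.finrank_range_add_finrank_ker (τ - lam • 1)
      omega
    have hranges : ∀ mu : k, mu ≠ lam → LinearMap.ker (τ - lam • 1) ≤
        LinearMap.range (τ - mu • 1) := by
      intro mu hmu y hy
      have hy' : τ y = lam • y := by simpa [sub_eq_zero] using hy
      refine ⟨(lam - mu)⁻¹ • y, ?_⟩
      have : lam - mu ≠ 0 := sub_ne_zero.mpr hmu.symm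
      rw [map_smul, LinearMap.sub_apply, hy', LinearMap.smul_apply, End.one_apply, ← sub_smul,
        smul_smul, inv_mul_cancel₀ this, one_smul]
    generalize hN : τ - lam • (1 : End k W) = N at *
    let K : Submodule k W := LinearMap.ker ((N - c • 1) * N)
    have hK : ∀ y, y ∈ K ↔ N (N y) = c • N y := by
      intro y
      simp [K, sub_eq_zero]
    have hlt : LinearMap.ker N < K := by
      refine lt_of_le_of_ne (fun y hy => ?_) fun he => hx ?_
      · rw [hK, LinearMap.mem_ker.mp hy]
        simp
      · rw [← LinearMap.mem_ker, he, hK, hxc]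
    have hnle : ¬ K ≤ LinearMap.range N := by
      intro hle
      have h1 := Submodule.finrank_lt_finrank_of_lt hlt
      have h2 := Submodule.finrank_mono hle
      omega
    obtain ⟨u, huK, huker, hur⟩ : ∃ u ∈ K, u ∉ LinearMap.ker N ∧ u ∉ LinearMap.range N := by
      by_contra! hcon
      have hsub : (K : Set W) ⊆ LinearMap.ker N ∪ LinearMap.range N :=
        fun y hy => or_iff_not_imp_left.mpr (hcon y hy)
      rcases AddSubgroupClass.subset_union.mp hsub with h1 | h1
      · exact hlt.not_ge h1
      · exact hnle h1
    refine key lam c u ?_ ?_ ?_ ?_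
    · rw [hN]
      exact (hK u).mp huK
    · rintro rfl
      exact huker (zero_mem _)
    · rw [hN]
      intro a ha
      rcases eq_or_ne a 0 with rfl | ha0
      · exact huker (by simpa using ha)
      · exact hur ⟨a⁻¹ • u, by rw [map_smul, ha, smul_smul, inv_mul_cancel₀ ha0, one_smul]⟩
    · intro mu hmu
      rcases eq_or_ne mu lam with rfl | hne
      · rw [hN] at hmu
        exact absurd hmu hur
      · by_contra! hsmall
        have heq := Submodule.eq_of_le_of_finrank_le (hranges mu hne) (by omega)
        exact huker (heq ▸ hmu)
  · have hbig : ∀ mu : k, n + 2 ≤ finrank k (LinearMap.range (τ - mu • 1)) := by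
      push Not at hcase
      intro mu
      have := h mu
      have := hcase mu
      omega
    have : Nontrivial W := nontrivial_of_finrank_pos (R := k) (by omega)
    obtain ⟨lam, hlam⟩ := End.exists_eigenvalue τ
    obtain ⟨z, hz⟩ := hlam.exists_hasEigenvector
    have hz1 : (τ - lam • 1) z = 0 := by simp [hz.apply_eq_smul]
    have hz0 : z ≠ 0 := hz.2
    obtain ⟨c, x, hx, hxc⟩ := exists_apply_eigenvector (hpos lam)
    by_cases hxa : ∃ a : k, (τ - lam • 1) x = a • x
    · obtain ⟨a, ha⟩ := hxa
      have hsum : (τ - lam • 1) (x + z) = (τ - lam • 1) x := by rw [map_add, hz1, add_zero]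
      have hne : ∀ b : k, (τ - lam • 1) (x + z) ≠ b • (x + z) := by
        intro b hb
        rw [hsum] at hb
        have hb0 : b ≠ 0 := by
          rintro rfl
          exact hx (by simpa using hb)
        have hab : (a - b) • (τ - lam • 1) x = 0 := by
          have := congrArg (τ - lam • (1 : End k W)) hb
          rw [map_smul, hsum] at this
          nth_rewrite 1 [ha] at this
          rw [map_smul] at this
          rw [sub_smul, this, sub_self]
        have hab' : a = b := sub_eq_zero.mp ((smul_eq_zero.mp hab).resolve_right hx)
        rw [ha, hab', smul_add, left_eq_add] at hb
        exact (smul_ne_zero hb0 hz0) hb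
      refine key lam c (x + z) (by rw [hsum, hxc]) ?_ hne fun mu _ => hbig mu
      intro h0
      exact hne 0 (by rw [h0]; simp)
    · push Not at hxa
      refine key lam c x hxc ?_ hxa fun mu _ => hbig mu
      rintro rfl
      exact hx (map_zero _)

open Module in
/-- If every `τ - lam` has rank at least half the dimension, then some subspace `V` of at most
half the dimension satisfies `V + τ V = W`. -/
theorem exists_sup_map_eq_top {k : Type*} [Field k] [IsAlgClosed k] (n : ℕ) :
    ∀ (W : Type*) [AddCommGroup W] [Module k W] [FiniteDimensional k W]
      (_ : finrank k W = 2 * n) (τ : End k W)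
      (_ : ∀ lam : k, n ≤ finrank k (LinearMap.range (τ - lam • 1))),
      ∃ V : Submodule k W, finrank k V ≤ n ∧ V ⊔ V.map τ = ⊤ := by
  induction n with
  | zero =>
    intro W _ _ _ hW τ _
    have : Subsingleton W := finrank_zero_iff.mp (by simpa using hW)
    exact ⟨⊥, by simp, Subsingleton.elim _ _⟩
  | succ n ih =>
    intro W _ _ _ hW τ h
    obtain ⟨u, a, b, hli, hquad, hr⟩ := exists_quadratic_vector hW τ h
    let U : Submodule k W := Submodule.span k {u, τ u}
    have huU : u ∈ U := Submodule.subset_span (by simp)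
    have hτuU : τ u ∈ U := Submodule.subset_span (by simp)
    have hU : finrank k U = 2 := by
      have := finrank_span_eq_card hli
      rwa [Matrix.range_cons_cons_empty, Fintype.card_fin] at this
    have hinv : U ≤ U.comap τ := by
      rw [Submodule.span_le]
      rintro y (rfl | rfl)
      · exact hτuU
      · change τ (τ u) ∈ U
        rw [hquad]
        exact add_mem (U.smul_mem _ huU) (U.smul_mem _ hτuU)
    have hquot : ∀ p : Submodule k W, 
        finrank k (p.map U.mkQ) + 2 = finrank k (U ⊔ p : Submodule k W) := by
      intro p
      have h1 := (Submodule.quotientQuotientEquivQuotient U (U ⊔ p) le_sup_left).finrank_eq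
      rw [Submodule.map_sup, Submodule.mkQ_map_self, bot_sup_eq] at h1
      have h2 := (p.map U.mkQ).finrank_quotient_add_finrank
      have h3 := (U ⊔ p).finrank_quotient_add_finrank
      have h4 := U.finrank_quotient_add_finrank
      omega
    have hWU : finrank k (W ⧸ U) = 2 * n := by
      have := U.finrank_quotient_add_finrank
      omega
    obtain ⟨V, hV, hVtop⟩ := ih (W ⧸ U) hWU (U.mapQ U τ hinv) fun lam => by
      have hrange : LinearMap.range (U.mapQ U τ hinv - lam • 1) =
          (LinearMap.range (τ - lam • 1)).map U.mkQ := by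
        rw [← LinearMap.range_comp, ← LinearMap.range_comp_of_range_eq_top
          (U.mapQ U τ hinv - lam • 1) U.range_mkQ]
        congr 1
      rw [hrange]
      have hq := hquot (LinearMap.range (τ - lam • 1))
      by_cases hu : u ∈ LinearMap.range (τ - lam • 1)
      · have h1 := hr lam hu
        have h2 := Submodule.finrank_mono (le_sup_right : LinearMap.range (τ - lam • 1) ≤ U ⊔ _)
        omega
      · have h1 := h lam
        have h2 := Submodule.finrank_lt_finrank_of_lt
          (lt_of_le_of_ne (le_sup_right : LinearMap.range (τ - lam • 1) ≤ U ⊔ _)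
            fun he => hu (he ▸ Submodule.mem_sup_left huU))
        omega
    obtain ⟨s, hs⟩ := U.mkQ.exists_rightInverse_of_surjective U.range_mkQ
    have hsV : (V.map s).map U.mkQ = V := by
      rw [← Submodule.map_comp, hs, Submodule.map_id]
    refine ⟨V.map s ⊔ Submodule.span k {u}, ?_, ?_⟩
    · have h1 := Submodule.finrank_add_le_finrank_add_finrank (V.map s) (Submodule.span k {u})
      have h2 := Submodule.finrank_map_le s V
      have h3 : finrank k (Submodule.span k {u}) ≤ 1 := by
        simpa using finrank_span_le_card (R := k) ({u} : Set W)
      omega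
    · set V' := V.map s ⊔ Submodule.span k {u}
      have huV : u ∈ V' := Submodule.mem_sup_right (Submodule.mem_span_singleton_self u)
      have hUle : U ≤ V' ⊔ V'.map τ := by
        rw [Submodule.span_le]
        rintro y (rfl | rfl)
        · exact Submodule.mem_sup_left huV
        · exact Submodule.mem_sup_right (Submodule.mem_map_of_mem huV)
      have hVle : V ≤ V'.map U.mkQ := by
        rw [← hsV]
        exact Submodule.map_mono le_sup_left
      have htop : (V' ⊔ V'.map τ).map U.mkQ = ⊤ := by
        rw [eq_top_iff, ← hVtop, Submodule.map_sup, ← Submodule.map_comp,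
          ← U.mapQ_mkQ U τ (h := hinv), Submodule.map_comp]
        exact sup_le_sup hVle (Submodule.map_mono hVle)
      rw [← sup_eq_right.mpr hUle, ← Submodule.comap_map_mkQ, htop, Submodule.comap_top]

theorem stmt_1 (k : Type*) [Field k] [IsAlgClosed k] (n : ℕ) (hn : 0 < n)
    (τ : Module.End k (Fin (2 * n) → k))
    (h : ∀ lam : k, Module.finrank k (Module.End.eigenspace τ lam) ≤ n) :
    ∃ V : Submodule k (Fin (2 * n) → k),
      Module.finrank k V = n ∧ IsCompl V (V.map τ) := by
  have hdim : Module.finrank k (Fin (2 * n) → k) = 2 * n := by simp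
  obtain ⟨V, hV, htop⟩ := exists_sup_map_eq_top n _ hdim τ fun lam => by
    have h1 := LinearMap.finrank_range_add_finrank_ker (τ - lam • 1)
    have h2 := h lam
    rw [Module.End.eigenspace_def] at h2
    omega
  have h1 := Submodule.finrank_sup_add_finrank_inf_eq V (V.map τ)
  have h2 := Submodule.finrank_map_le τ V
  rw [htop, finrank_top, hdim] at h1
  refine ⟨V, by omega, ?_, codisjoint_iff.mpr htop⟩
  rw [disjoint_iff, ← Submodule.finrank_eq_zero (R := k)]
  omega
end

section
/- Let k be an infinite field and I a homogeneous ideal of k[x₁,…,x_m] with dim(k[x]/I) = d. Then for every c with 0 ≤ c ≤ d there exist linear forms g₁,…,g_c ∈ k[x]₁ such that dim(k[x]/(I + (g₁,…,g_c))) = d − c. -/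
open MvPolynomial

attribute [local instance] MvPolynomial.gradedAlgebra

theorem ringKrullDim_le_of_isIntegral (R S : Type*) [CommRing R] [CommRing S] [Algebra R S]
    [Algebra.IsIntegral R S] : ringKrullDim S ≤ ringKrullDim R :=
  Order.krullDim_le_of_strictMono (PrimeSpectrum.comap (algebraMap R S)) fun _ _ h =>
    Ideal.IsIntegral.comap_lt_comap h

namespace MvPolynomial

variable {σ k : Type*} [Field k]

theorem isMaximal_ker_constantCoeff :
    (RingHom.ker (constantCoeff : MvPolynomial σ k →+* k)).IsMaximal :=
  RingHom.ker_isMaximal_of_surjective _ fun a => ⟨C a, constantCoeff_C _ a⟩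

theorem ker_constantCoeff_le_of_X_mem {P : Ideal (MvPolynomial σ k)} (h : ∀ i, X i ∈ P) :
    RingHom.ker (constantCoeff : MvPolynomial σ k →+* k) ≤ P := by
  intro p hp
  rw [← p.support_sum_monomial_coeff]
  refine Ideal.sum_mem _ fun s hs => ?_
  obtain ⟨i, hi⟩ : ∃ i, s i ≠ 0 := by
    by_contra! hs'
    obtain rfl : s = 0 := Finsupp.ext hs'
    exact mem_support_iff.mp hs hp
  have hdvd : (X i : MvPolynomial σ k) ∣ monomial s (coeff s p) := by
    rw [X_dvd_monomial]
    exact Or.inr hi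
  exact P.mem_of_dvd hdvd (h i)

theorem le_ker_constantCoeff_of_isHomogeneous {I : Ideal (MvPolynomial σ k)}
    (hI : I.IsHomogeneous (homogeneousSubmodule σ k)) (hne : I ≠ ⊤) :
    I ≤ RingHom.ker (constantCoeff : MvPolynomial σ k →+* k) := by
  intro p hp
  by_contra hp'
  have h0 : homogeneousComponent 0 p ∈ I := by
    have := hI 0 hp
    rwa [← decomposition.decompose'_apply]
  rw [homogeneousComponent_zero] at h0
  exact hne (I.eq_top_of_isUnit_mem h0 ((IsUnit.mk0 _ hp').map C))

/-- A proper homogeneous ideal of dimension at most zero is primary to the irrelevant ideal. -/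
theorem X_mem_radical_of_ringKrullDim_le_zero {I : Ideal (MvPolynomial σ k)}
    (hI : I.IsHomogeneous (homogeneousSubmodule σ k))
    (hdim : ringKrullDim (MvPolynomial σ k ⧸ I) ≤ 0) (i : σ) : X i ∈ I.radical := by
  rw [Ideal.radical_eq_sInf, Submodule.mem_sInf]
  rintro P ⟨hIP, hP⟩
  let Q := (Ideal.homogeneousCore (homogeneousSubmodule σ k) P).toIdeal
  have hQP : Q ≤ P := Ideal.toIdeal_homogeneousCore_le _ P
  have hQ : Q.IsPrime := hP.homogeneousCore
  have hQh : Q.IsHomogeneous (homogeneousSubmodule σ k) := HomogeneousIdeal.isHomogeneous _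
  have hIQ : I ≤ Q := by
    rw [← hI.toIdeal_homogeneousCore_eq_self]
    exact Ideal.homogeneousCore_mono _ hIP
  have hQm := le_ker_constantCoeff_of_isHomogeneous hQh hQ.ne_top
  have hm := isMaximal_ker_constantCoeff (σ := σ) (k := k)
  refine hQP ?_
  by_contra hX
  have hlt : Q < RingHom.ker (constantCoeff : MvPolynomial σ k →+* k) :=
    lt_of_le_of_ne hQm fun h => hX (h ▸ by simp [RingHom.mem_ker])
  rw [ringKrullDim_quotient, Order.krullDim_nonpos_iff_forall_isMax] at hdim
  have hmax := hdim ⟨⟨Q, hQ⟩, hIQ⟩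
  exact hmax.not_lt (b := ⟨⟨_, hm.isPrime⟩, hIQ.trans hQm⟩) hlt

/-- A homogeneous ideal whose quotient becomes at most zero-dimensional after dividing out
linear forms `h` has a quotient that is a finite module over the subalgebra generated by `h`. -/
theorem finite_aeval_quotient [Finite σ] {ι : Type*} [Finite ι] {I : Ideal (MvPolynomial σ k)}
    (hI : I.IsHomogeneous (homogeneousSubmodule σ k)) (h : ι → MvPolynomial σ k)
    (hh : ∀ i, (h i).IsHomogeneous 1)
    (hX : ∀ i, X i ∈ (I ⊔ Ideal.span (Set.range h)).radical) :
    ((Ideal.Quotient.mk I).comp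
      (aeval h : MvPolynomial ι k →ₐ[k] MvPolynomial σ k).toRingHom).Finite := by
  classical
  have := Fintype.ofFinite ι
  let := (aeval h : MvPolynomial ι k →ₐ[k] MvPolynomial σ k).toRingHom.toAlgebra
  have smul_def (p : MvPolynomial ι k) (q : MvPolynomial σ k) : p • q = aeval h p * q := rfl
  choose n hn using hX
  let B : Set (MvPolynomial σ k) :=
    (fun s => monomial s 1) '' Set.Iic (Finsupp.equivFunOnFinite.symm n)
  have hB : B.Finite := (Set.finite_Iic _).image _
  let N : Submodule (MvPolynomial ι k) (MvPolynomial σ k) :=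
    Submodule.span (MvPolynomial ι k) B ⊔ I.restrictScalars (MvPolynomial ι k)
  have hIN {p} (hp : p ∈ I) : p ∈ N := Submodule.mem_sup_right hp
  have hC {p} (a : k) (hp : p ∈ N) : C a * p ∈ N := by
    have := N.smul_mem (C a) hp
    rwa [smul_def, aeval_C] at this
  have hhN {p} (i : ι) (hp : p ∈ N) : p * h i ∈ N := by
    have := N.smul_mem (X i) hp
    rwa [smul_def, aeval_X, mul_comm] at this
  have hhom (D : ℕ) : ∀ p : MvPolynomial σ k, p.IsHomogeneous D → p ∈ N := by
    induction D using Nat.strong_induction_on with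
    | _ D ih =>
    intro p hp
    rw [← p.support_sum_monomial_coeff]
    refine N.sum_mem fun s hs => ?_
    rw [← mul_one (coeff s p), ← C_mul_monomial]
    refine hC _ ?_
    have hsD : (monomial s (1 : k)).IsHomogeneous D :=
      isHomogeneous_monomial _ <| by
        rw [Finsupp.degree_eq_weight_one]
        exact hp (mem_support_iff.mp hs)
    by_cases hsn : s ≤ Finsupp.equivFunOnFinite.symm n
    · exact Submodule.mem_sup_left (Submodule.subset_span ⟨s, hsn, rfl⟩)
    obtain ⟨i, hi⟩ : ∃ i, n i ≤ s i := by
      by_contra! hlt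
      exact hsn fun i => (hlt i).le
    have hmem : monomial s (1 : k) ∈ I ⊔ Ideal.span (Set.range h) := by
      refine Ideal.mem_of_dvd _ ?_ (hn i)
      rw [X_pow_eq_monomial, monomial_dvd_monomial]
      exact ⟨Or.inr (Finsupp.single_le_iff.mpr hi), one_dvd _⟩
    obtain ⟨a, ha, b, hb, hab⟩ := Submodule.mem_sup.mp hmem
    obtain ⟨c, rfl⟩ := Ideal.mem_span_range_iff_exists_fun.mp hb
    have hdec := congrArg (homogeneousComponent D) hab
    rw [homogeneousComponent_of_mem hsD, if_pos rfl, map_add, map_sum] at hdec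
    rw [← hdec]
    refine N.add_mem (hIN ?_) (N.sum_mem fun j _ => ?_)
    · have := hI D ha
      rwa [← decomposition.decompose'_apply]
    · have hmul := DirectSum.coe_decompose_mul_of_right_mem (𝒜 := homogeneousSubmodule σ k)
        (a := c j) D (hh j)
      erw [decomposition.decompose'_apply] at hmul
      rw [hmul]
      split_ifs with hD
      · exact hhN j (ih (D - 1) (by omega) _
          (DirectSum.decompose (homogeneousSubmodule σ k) (c j) (D - 1)).2)
      · exact N.zero_mem
  have hN : N = ⊤ := by
    refine Submodule.eq_top_iff'.mpr fun p => ?_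
    rw [← sum_homogeneousComponent p]
    exact N.sum_mem fun D _ => hhom D _ (homogeneousComponent_isHomogeneous D p)
  let := ((Ideal.Quotient.mk I).comp
    (aeval h : MvPolynomial ι k →ₐ[k] MvPolynomial σ k).toRingHom).toAlgebra
  let π : MvPolynomial σ k →ₗ[MvPolynomial ι k] MvPolynomial σ k ⧸ I :=
    { (Ideal.Quotient.mk I) with map_smul' := fun p q => map_mul (Ideal.Quotient.mk I) _ _ }
  refine ⟨Submodule.fg_def.mpr ⟨π '' B, hB.image π, ?_⟩⟩
  refine Submodule.eq_top_iff'.mpr fun y => ?_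
  obtain ⟨x, rfl⟩ := Ideal.Quotient.mk_surjective y
  obtain ⟨a, ha, b, hb, rfl⟩ := Submodule.mem_sup.mp (hN ▸ Submodule.mem_top : x ∈ N)
  rw [map_add, Ideal.Quotient.eq_zero_iff_mem.mpr hb, add_zero]
  refine (Submodule.span_image π).ge ?_
  exact Submodule.mem_map_of_mem (f := π) ha

theorem ringKrullDim_quotient_le_natCard [Finite σ] {ι : Type*} [Finite ι]
    {I : Ideal (MvPolynomial σ k)}
    (hI : I.IsHomogeneous (homogeneousSubmodule σ k)) (h : ι → MvPolynomial σ k)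
    (hh : ∀ i, (h i).IsHomogeneous 1)
    (hdim : ringKrullDim (MvPolynomial σ k ⧸ (I ⊔ Ideal.span (Set.range h))) ≤ 0) :
    ringKrullDim (MvPolynomial σ k ⧸ I) ≤ Nat.card ι := by
  have hspan : (Ideal.span (Set.range h)).IsHomogeneous (homogeneousSubmodule σ k) :=
    Ideal.homogeneous_span _ _ (by rintro _ ⟨i, rfl⟩; exact ⟨1, hh i⟩)
  let f := (Ideal.Quotient.mk I).comp (aeval h : MvPolynomial ι k →ₐ[k] _).toRingHom
  have hf : f.Finite :=
    finite_aeval_quotient hI h hh (X_mem_radical_of_ringKrullDim_le_zero (hI.sup hspan) hdim)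
  let := f.toAlgebra
  have : Algebra.IsIntegral (MvPolynomial ι k) (MvPolynomial σ k ⧸ I) := ⟨hf.to_isIntegral⟩
  simpa using ringKrullDim_le_of_isIntegral (MvPolynomial ι k) (MvPolynomial σ k ⧸ I)

/-- Over an infinite field, some linear form avoids all minimal primes of `I` except possibly the
irrelevant ideal, and so lowers a positive dimension. -/
theorem exists_linear_ringKrullDim_le [Infinite k] [Finite σ]
    (I : Ideal (MvPolynomial σ k)) (d : ℕ)
    (hdim : ringKrullDim (MvPolynomial σ k ⧸ I) ≤ (d + 1 : ℕ)) :
    ∃ g : MvPolynomial σ k, g.IsHomogeneous 1 ∧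
      ringKrullDim (MvPolynomial σ k ⧸ (I ⊔ Ideal.span {g})) ≤ d := by
  let 𝔪 := RingHom.ker (constantCoeff : MvPolynomial σ k →+* k)
  have hm : 𝔪.IsMaximal := isMaximal_ker_constantCoeff
  let V := homogeneousSubmodule σ k 1
  have hfin : (I.minimalPrimes \ {𝔪}).Finite :=
    (I.finite_minimalPrimes_of_isNoetherianRing _).sdiff
  let φ : Ideal (MvPolynomial σ k) → Subspace k V := fun P =>
    (P.restrictScalars k).comap V.subtype
  classical
  have htop : ⊤ ∉ hfin.toFinset.image φ := by
    simp only [Finset.mem_image, Set.Finite.mem_toFinset, not_exists, not_and]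
    rintro P ⟨hP, hPm⟩ hPtop
    refine hPm (hm.eq_of_le hP.1.1.ne_top (ker_constantCoeff_le_of_X_mem fun i => ?_)).symm
    have : (⟨X i, isHomogeneous_X k i⟩ : V) ∈ φ P := hPtop ▸ Submodule.mem_top
    exact this
  obtain ⟨g, hg⟩ := (Set.ne_univ_iff_exists_notMem _).mp
    (Subspace.biUnion_ne_univ_of_top_notMem htop)
  refine ⟨g, g.2, ?_⟩
  have hg' : ∀ P ∈ I.minimalPrimes, (g : MvPolynomial σ k) ∈ P → P = 𝔪 := by
    intro P hP hgP
    by_contra hne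
    refine hg (Set.mem_biUnion (Finset.mem_coe.mpr <| Finset.mem_image_of_mem φ ?_) hgP)
    simpa using ⟨hP, hne⟩
  rw [ringKrullDim_quotient] at hdim ⊢
  refine iSup_le fun l => ?_
  obtain ⟨hIl, hgl⟩ : I ≤ l.head.1.asIdeal ∧ (g : MvPolynomial σ k) ∈ l.head.1.asIdeal := by
    have h := (PrimeSpectrum.mem_zeroLocus _ _).mp l.head.2
    rwa [SetLike.coe_subset_coe, sup_le_iff, Ideal.span_singleton_le_iff_mem] at h
  obtain ⟨Q, hQ, hQl⟩ := Ideal.exists_minimalPrimes_le hIl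
  by_cases hgQ : (g : MvPolynomial σ k) ∈ Q
  · obtain rfl := hg' Q hQ hgQ
    have hlen : l.length = 0 := by
      by_contra hlen
      have hlt : l.head < l.last := l.strictMono (Fin.lt_def.mpr (Nat.pos_of_ne_zero hlen))
      exact (hm.eq_of_le l.last.1.2.ne_top (hQl.trans hlt.le)).not_lt (hQl.trans_lt hlt)
    rw [hlen]
    exact_mod_cast Nat.zero_le d
  · have hle : I ≤ I ⊔ Ideal.span {(g : MvPolynomial σ k)} := le_sup_left
    let l' : LTSeries (PrimeSpectrum.zeroLocus (I : Set (MvPolynomial σ k))) :=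
      l.map (fun p => ⟨p.1, fun x hx => p.2 (hle hx)⟩) fun _ _ h => h
    let q : PrimeSpectrum.zeroLocus (I : Set (MvPolynomial σ k)) := ⟨⟨Q, hQ.1.1⟩, hQ.1.2⟩
    have hq : q < l'.head := lt_of_le_of_ne hQl fun h => hgQ (by
      have : Q = l.head.1.asIdeal := congrArg (fun p => p.1.asIdeal) h
      exact this ▸ hgl)
    have := (Order.LTSeries.length_le_krullDim (l'.cons q hq)).trans hdim
    have hlen : (l'.cons q hq).length ≤ d + 1 := by exact_mod_cast this
    rw [RelSeries.cons_length] at hlen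
    have hlen' : l.length ≤ d := Nat.le_of_succ_le_succ hlen
    exact_mod_cast hlen'

theorem exists_linear_family_ringKrullDim_le [Infinite k] [Finite σ] (c d : ℕ)
    (I : Ideal (MvPolynomial σ k))
    (hdim : ringKrullDim (MvPolynomial σ k ⧸ I) ≤ (d + c : ℕ)) :
    ∃ g : Fin c → MvPolynomial σ k, (∀ i, (g i).IsHomogeneous 1) ∧
      ringKrullDim (MvPolynomial σ k ⧸ (I ⊔ Ideal.span (Set.range g))) ≤ d := by
  induction c generalizing I with
  | zero => exact ⟨Fin.elim0, fun i => i.elim0, by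
      rw [Set.range_eq_empty, Ideal.span_empty, sup_bot_eq]; exact hdim⟩
  | succ c ih =>
    obtain ⟨g₀, hg₀, hdim₀⟩ := exists_linear_ringKrullDim_le I (d + c) hdim
    obtain ⟨g, hg, hdim'⟩ := ih _ hdim₀
    refine ⟨Fin.cons g₀ g, Fin.cases hg₀ hg, ?_⟩
    rwa [Fin.range_cons, Ideal.span_insert, ← sup_assoc]

end MvPolynomial

theorem stmt_11 (k : Type*) [Field k] [Infinite k] (m : ℕ)
    (I : Ideal (MvPolynomial (Fin m) k))
    (hI : Ideal.IsHomogeneous (homogeneousSubmodule (Fin m) k) I)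
    (d : ℕ) (hdim : ringKrullDim (MvPolynomial (Fin m) k ⧸ I) = d)
    (c : ℕ) (hc : c ≤ d) :
    ∃ g : Fin c → MvPolynomial (Fin m) k, (∀ i, (g i).IsHomogeneous 1) ∧
      ringKrullDim (MvPolynomial (Fin m) k ⧸ (I + Ideal.span (Set.range g)))
        = (d - c : ℕ) := by
  obtain ⟨g, hg, hle⟩ := exists_linear_family_ringKrullDim_le c (d - c) I
    (by rw [hdim, Nat.sub_add_cancel hc])
  refine ⟨g, hg, ?_⟩
  rw [Submodule.add_eq_sup]
  set J := I ⊔ Ideal.span (Set.range g)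
  have hIne : I ≠ ⊤ := by
    rintro rfl
    rw [ringKrullDim_eq_bot_of_subsingleton] at hdim
    exact WithBot.bot_ne_coe hdim
  have hJm : J ≤ RingHom.ker (constantCoeff : MvPolynomial (Fin m) k →+* k) := by
    refine sup_le (le_ker_constantCoeff_of_isHomogeneous hI hIne) (Ideal.span_le.mpr ?_)
    rintro _ ⟨i, rfl⟩
    exact (hg i).coeff_eq_zero (by simp)
  have : Nontrivial (MvPolynomial (Fin m) k ⧸ J) := Ideal.Quotient.nontrivial_iff.mpr
    (ne_top_of_le_ne_top isMaximal_ker_constantCoeff.ne_top hJm)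
  obtain ⟨e, he⟩ : ∃ e : ℕ, ringKrullDim (MvPolynomial (Fin m) k ⧸ J) = e := by
    have h0 := ringKrullDim_nonneg_of_nontrivial (R := MvPolynomial (Fin m) k ⧸ J)
    generalize ringKrullDim (MvPolynomial (Fin m) k ⧸ J) = a at h0 hle
    induction a with
    | bot => simp at h0
    | coe a =>
      have ha : a ≤ (d - c : ℕ) := WithBot.coe_le_coe.mp hle
      obtain ⟨e, rfl⟩ := ENat.ne_top_iff_exists.mp (ne_top_of_le_ne_top (ENat.natCast_ne_top _) ha)
      exact ⟨e, rfl⟩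
  obtain ⟨f, hf, hf0⟩ := exists_linear_family_ringKrullDim_le e 0 J (by simp [he])
  have hd := ringKrullDim_quotient_le_natCard hI (Sum.elim g f)
    (by rintro (i | i); exacts [hg i, hf i])
    (by rwa [Set.Sum.elim_range, Ideal.span_union, ← sup_assoc])
  rw [hdim, Nat.card_sum, Nat.card_fin, Nat.card_fin] at hd
  rw [he] at hle ⊢
  have h₁ : d ≤ c + e := by exact_mod_cast hd
  have h₂ : e ≤ d - c := by exact_mod_cast hle
  congr 2
  omega
end
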